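/- Fix δ ∈ (0,1/2). For every bounded rectangle A in [0,1]^d and all reals x < y (y = +∞ allowed, with the conventions u_N(+∞) = +∞ and e^{−∞} = 0), the sum over α ∈ V_N^δ with α/n ∈ A of P(u_N(x) < ψ_α ≤ u_N(y)) converges, as n → ∞, to |A ∩ [δ, 1−δ]^d|·(e^{−x} − e^{−y}). -/

import Mathlib

open MeasureTheory ProbabilityTheory Real Filter Set

/-- `ℤ^d` as functions `Fin d → ℤ`. -/
abbrev Zd (d : ℕ) := Fin d → ℤ

/-- One step of the simple random walk: move from `a` by `±1` in coordinate `i`. -/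
def rwStep (d : ℕ) (i : Fin d) (s : Bool) (a : Zd d) : Zd d :=
  Function.update a i (a i + if s then 1 else -1)

/-- `m`-step transition probability of the simple random walk on `ℤ^d`. -/
noncomputable def rwP (d : ℕ) : ℕ → Zd d → Zd d → ℝ
  | 0, a, b => if a = b then 1 else 0
  | (m+1), a, b => (1 / (2 * d)) * ∑ i : Fin d, ∑ s : Bool, rwP d m (rwStep d i s a) b

/-- The Green's function `g(a,b)` of the simple random walk on `ℤ^d`. -/
noncomputable def green (d : ℕ) (a b : Zd d) : ℝ := ∑' m, rwP d m a b

open Classical in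
/-- Probability that the walk started at `a` is at `b` at time `m`, having stayed in `Λ`
at all times `0,…,m`. -/
noncomputable def rwPIn (d : ℕ) (Λ : Set (Zd d)) : ℕ → Zd d → Zd d → ℝ
  | 0, a, b => if a = b ∧ a ∈ Λ then 1 else 0
  | (m+1), a, b =>
      if a ∈ Λ then (1 / (2 * d)) * ∑ i : Fin d, ∑ s : Bool, rwPIn d Λ m (rwStep d i s a) b
      else 0

/-- Dirichlet Green's function `g_Λ(a,b)` (killed upon exiting `Λ`). -/
noncomputable def greenIn (d : ℕ) (Λ : Set (Zd d)) (a b : Zd d) : ℝ := ∑' m, rwPIn d Λ m a b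

open Classical in
/-- Probability that the walk started at `a` first hits `F` at time `m`, at the point `b`. -/
noncomputable def hitP (d : ℕ) (F : Set (Zd d)) : ℕ → Zd d → Zd d → ℝ
  | 0, a, b => if a = b ∧ b ∈ F then 1 else 0
  | (m+1), a, b =>
      if a ∈ F then 0
      else (1 / (2 * d)) * ∑ i : Fin d, ∑ s : Bool, hitP d F m (rwStep d i s a) b

open Classical in
/-- Probability that the walk started at `a` first hits `F` at time `m`, at the point `b`,
before exiting `Λ`. -/
noncomputable def hitPIn (d : ℕ) (Λ F : Set (Zd d)) : ℕ → Zd d → Zd d → ℝ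
  | 0, a, b => if a = b ∧ b ∈ F ∧ b ∈ Λ then 1 else 0
  | (m+1), a, b =>
      if a ∈ Λ ∧ a ∉ F then
        (1 / (2 * d)) * ∑ i : Fin d, ∑ s : Bool, hitPIn d Λ F m (rwStep d i s a) b
      else 0

/-- `ℙ_a(H_F < ∞, S_{H_F} = b)`, the harmonic measure of `F` seen from `a`. -/
noncomputable def hitMeas (d : ℕ) (F : Set (Zd d)) (a b : Zd d) : ℝ := ∑' m, hitP d F m a b

/-- `ℙ_a(H_F < H_{ℤ^d∖Λ}, S_{H_F} = b)`. -/
noncomputable def hitMeasIn (d : ℕ) (Λ F : Set (Zd d)) (a b : Zd d) : ℝ :=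
  ∑' m, hitPIn d Λ F m a b

/-- `(φ_a)_{a∈ℤ^d}` is a centered Gaussian field with covariance `G`: every finite linear
combination is a centered Gaussian with the prescribed variance. -/
def IsGaussianField {Ω : Type*} [MeasurableSpace Ω] (P : Measure Ω) (d : ℕ)
    (G : Zd d → Zd d → ℝ) (φ : Zd d → Ω → ℝ) : Prop :=
  (∀ a, Measurable (φ a)) ∧
    ∀ c : Zd d →₀ ℝ,
      Measure.map (fun ω => ∑ a ∈ c.support, c a * φ a ω) P =
        gaussianReal 0
          (Real.toNNReal (∑ a ∈ c.support, ∑ b ∈ c.support, c a * c b * G a b))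

/-- The centering sequence `b_N` (here `g0 = g(0)` is the variance of the field). -/
noncomputable def bN (g0 : ℝ) (N : ℕ) : ℝ :=
  Real.sqrt g0 * (Real.sqrt (2 * Real.log N) -
    (Real.log (Real.log N) + Real.log (4 * π)) / (2 * Real.sqrt (2 * Real.log N)))

/-- The scaling sequence `a_N = g(0)/b_N`. -/
noncomputable def aN (g0 : ℝ) (N : ℕ) : ℝ := g0 / bN g0 N

/-- `u_N(z) = a_N z + b_N`. -/
noncomputable def uN (g0 : ℝ) (N : ℕ) (z : ℝ) : ℝ := aN g0 N * z + bN g0 N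

/-- The box `V_N = ([0,n-1]^d) ∩ ℤ^d`, `N = n^d`. -/
noncomputable def VN (d n : ℕ) : Finset (Zd d) :=
  Fintype.piFinset fun _ => Finset.Icc (0 : ℤ) ((n : ℤ) - 1)

/-- The `ℓ∞` distance between two points of `ℤ^d`, as a real number. -/
noncomputable def distInf (d : ℕ) (a b : Zd d) : ℝ :=
  ((Finset.univ.sup fun i => (a i - b i).natAbs : ℕ) : ℝ)

open Classical in
/-- The bulk `V_N^δ` of the box `V_N`. -/
noncomputable def bulk (d n : ℕ) (δ : ℝ) : Finset (Zd d) :=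
  (VN d n).filter fun a => ∀ b : Zd d, b ∉ VN d n → δ * n < distInf d a b

/-- The rectangle `∏_i ([0,1] ∩ (lo i, hi i])` in `[0,1]^d`. -/
def rect (d : ℕ) (lo hi : Fin d → ℝ) : Set (Fin d → ℝ) :=
  {t | ∀ i, t i ∈ Set.Icc (0 : ℝ) 1 ∩ Set.Ioc (lo i) (hi i)}

open Classical in
/-- `nA ∩ V_N = {α ∈ V_N : α/n ∈ A}` for the rectangle `A = rect d lo hi`. -/
noncomputable def rectIdx (d n : ℕ) (lo hi : Fin d → ℝ) : Finset (Zd d) :=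
  (VN d n).filter fun a => (fun i => (a i : ℝ) / n) ∈ rect d lo hi

/-- `e^{-y}` for `y ∈ (-∞,+∞]`, with the convention `e^{-∞} = 0`. -/
noncomputable def expE (y : EReal) : ℝ := if y = ⊤ then 0 else Real.exp (-y.toReal)

/-- `u_N` extended to `(-∞,+∞]` by `u_N(+∞) = +∞`. -/
noncomputable def uNE (g0 : ℝ) (N : ℕ) (y : EReal) : EReal :=
  if y = ⊤ then ⊤ else ((uN g0 N y.toReal : ℝ) : EReal)

/-- `ω(R) = ∫_R e^{-z} dz` for `R ⊆ (-∞,+∞]`. -/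
noncomputable def omegaMeas (R : Set EReal) : ℝ :=
  ∫ t in {t : ℝ | (t : EReal) ∈ R}, Real.exp (-t)

/-- `R ⊆ (-∞,+∞]` is a finite union of disjoint intervals `(x,y]` with
`-∞ < x < y ≤ +∞`. -/
def IsFiniteUnionIoc (R : Set EReal) : Prop :=
  ∃ (m : ℕ) (w : Fin m → ℝ) (r : Fin m → EReal),
    (∀ l, (w l : EReal) < r l) ∧
    (Pairwise fun l l' =>
      Disjoint (Set.Ioc (w l : EReal) (r l)) (Set.Ioc (w l' : EReal) (r l'))) ∧
    R = ⋃ l, Set.Ioc ((w l : ℝ) : EReal) (r l)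


/-- The box `[δ, 1-δ]^d`. -/
def deltaBox (d : ℕ) (δ : ℝ) : Set (Fin d → ℝ) := {t | ∀ i, t i ∈ Set.Icc δ (1 - δ)}

open Classical in
/-- `{α ∈ V_N^δ : α/n ∈ A}` for the rectangle `A = rect d lo hi`. -/
noncomputable def rectIdxBulk (d n : ℕ) (δ : ℝ) (lo hi : Fin d → ℝ) : Finset (Zd d) :=
  (bulk d n δ).filter fun a => (fun i => (a i : ℝ) / n) ∈ rect d lo hi

/-- Lebesgue measure on the torus `(-π, π]^d`. -/
noncomputable def torusMeasure (d : ℕ) : Measure (Fin d → ℝ) :=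
  Measure.pi fun _ => volume.restrict (Set.Ioc (-π) π)

instance torusMeasure.isFiniteMeasure (d : ℕ) : IsFiniteMeasure (torusMeasure d) := by
  unfold torusMeasure; infer_instance

/-- The characteristic function of one step of the simple random walk. -/
noncomputable def stepChar (d : ℕ) (θ : Fin d → ℝ) : ℝ := (1 / d) * ∑ i, Real.cos (θ i)

/-- The character `θ ↦ exp(i ⟨k, θ⟩)`. -/
noncomputable def latticeChar (d : ℕ) (k : Zd d) (θ : Fin d → ℝ) : ℂ :=
  Complex.exp (((∑ i, (k i : ℝ) * θ i : ℝ) : ℂ) * Complex.I)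

lemma abs_stepChar_le_exp (d : ℕ) (hd : 0 < d) (θ : Fin d → ℝ) :
    |stepChar d θ| ≤ ∏ i, Real.exp (-(1 / (2 * d)) * Real.sin (θ i) ^ 2) := by
  have hd' : (0 : ℝ) < d := by exact_mod_cast hd
  rw [← Real.exp_sum]
  refine le_trans ?_ (Real.add_one_le_exp _)
  unfold stepChar
  rw [abs_mul, abs_of_pos (by positivity : (0 : ℝ) < 1 / d)]
  have h1 : |∑ i, Real.cos (θ i)| ≤ ∑ i : Fin d, (1 - Real.sin (θ i) ^ 2 / 2) := by
    refine (Finset.abs_sum_le_sum_abs _ _).trans (Finset.sum_le_sum fun i _ => ?_)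
    have := Real.sin_sq_add_cos_sq (θ i)
    rw [abs_le]
    constructor <;> nlinarith [sq_nonneg (Real.cos (θ i) - 1), sq_nonneg (Real.cos (θ i) + 1)]
  calc (1 / (d : ℝ)) * |∑ i, Real.cos (θ i)|
      ≤ (1 / (d : ℝ)) * ∑ i : Fin d, (1 - Real.sin (θ i) ^ 2 / 2) := by gcongr
    _ = _ := by
      rw [Finset.sum_sub_distrib, ← Finset.mul_sum, ← Finset.sum_div]
      simp only [Finset.sum_const, Finset.card_univ, Fintype.card_fin, nsmul_eq_mul, mul_one]
      field_simp
      ring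

lemma abs_stepChar_le_one (d : ℕ) (θ : Fin d → ℝ) : |stepChar d θ| ≤ 1 := by
  rcases Nat.eq_zero_or_pos d with rfl | hd
  · simp [stepChar]
  · refine (abs_stepChar_le_exp d hd θ).trans (Finset.prod_le_one (fun _ _ => by positivity) ?_)
    intro i _
    rw [Real.exp_le_one_iff, neg_mul]
    have : 0 ≤ 1 / (2 * (d : ℝ)) * Real.sin (θ i) ^ 2 := by positivity
    linarith

lemma continuous_stepChar (d : ℕ) : Continuous (stepChar d) := by
  unfold stepChar; fun_prop

lemma continuous_latticeChar (d : ℕ) (k : Zd d) : Continuous (latticeChar d k) := by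
  unfold latticeChar; fun_prop

lemma norm_latticeChar (d : ℕ) (k : Zd d) (θ : Fin d → ℝ) : ‖latticeChar d k θ‖ = 1 :=
  Complex.norm_exp_ofReal_mul_I _

lemma integrable_latticeChar_mul_pow (d m : ℕ) (k : Zd d) :
    Integrable (fun θ => latticeChar d k θ * ((stepChar d θ : ℝ) : ℂ) ^ m) (torusMeasure d) := by
  refine Integrable.of_bound (C := 1) ?_ (ae_of_all _ fun θ => ?_)
  · have h1 := continuous_latticeChar d k
    have h2 := continuous_stepChar d
    exact Continuous.aestronglyMeasurable (by fun_prop)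
  · rw [norm_mul, norm_latticeChar, norm_pow, Complex.norm_real, one_mul]
    exact pow_le_one₀ (norm_nonneg _) (abs_stepChar_le_one d θ)

lemma integral_exp_int_mul_I (k : ℤ) :
    ∫ t in Set.Ioc (-π) π, Complex.exp ((((k : ℝ) * t : ℝ) : ℂ) * Complex.I) =
      if k = 0 then 2 * π else 0 := by
  rw [← intervalIntegral.integral_of_le (by linarith [Real.pi_pos])]
  split_ifs with hk
  · subst hk
    simp
    ring
  · have hc : ((k : ℂ) * Complex.I) ≠ 0 := by simp [hk]
    have h := integral_exp_mul_complex (a := -π) (b := π) hc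
    have h2 : ∀ t : ℝ, Complex.exp ((((k : ℝ) * t : ℝ) : ℂ) * Complex.I) =
        Complex.exp ((k : ℂ) * Complex.I * t) := by
      intro t; congr 1; push_cast; ring
    simp_rw [h2]
    rw [h, Complex.ofReal_zero, div_eq_zero_iff]
    left
    rw [sub_eq_zero, Complex.exp_eq_exp_iff_exists_int]
    exact ⟨k, by push_cast; ring⟩

lemma integral_latticeChar (d : ℕ) (k : Zd d) :
    ∫ θ, latticeChar d k θ ∂(torusMeasure d) = if k = 0 then (2 * (π : ℂ)) ^ d else 0 := by
  have h : ∀ θ, latticeChar d k θ =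
      ∏ i, (fun i t => Complex.exp ((((k i : ℝ) * t : ℝ) : ℂ) * Complex.I)) i (θ i) := by
    intro θ
    rw [← Complex.exp_sum]
    unfold latticeChar
    congr 1
    push_cast
    rw [Finset.sum_mul]
  rw [integral_congr_ae (ae_of_all _ h)]
  unfold torusMeasure
  rw [integral_fintype_prod_eq_prod
    (fun i (t : ℝ) => Complex.exp ((((k i : ℝ) * t : ℝ) : ℂ) * Complex.I))]
  simp_rw [integral_exp_int_mul_I]
  split_ifs with hk
  · subst hk; simp
  · obtain ⟨i, hi⟩ := Function.ne_iff.mp hk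
    exact Finset.prod_eq_zero (Finset.mem_univ i) (by simpa using hi)

lemma sum_latticeChar_rwStep (d : ℕ) (a b : Zd d) (θ : Fin d → ℝ) :
    (1 / (2 * (d : ℂ))) * ∑ i : Fin d, ∑ s : Bool, latticeChar d (rwStep d i s a - b) θ =
      latticeChar d (a - b) θ * ((stepChar d θ : ℝ) : ℂ) := by
  have h : ∀ (i : Fin d) (e : ℤ),
      latticeChar d (Function.update a i (a i + e) - b) θ =
        latticeChar d (a - b) θ * Complex.exp ((e : ℂ) * ((θ i : ℝ) : ℂ) * Complex.I) := by
    intro i e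
    unfold latticeChar
    rw [← Complex.exp_add, ← add_mul]
    congr 2
    have : ∀ j, (((Function.update a i (a i + e) - b) j : ℤ) : ℝ) * θ j =
        ((a - b) j : ℤ) * θ j + if j = i then (e : ℝ) * θ j else 0 := by
      intro j
      by_cases hj : j = i
      · subst hj; simp; ring
      · simp [hj]
    simp_rw [this, Finset.sum_add_distrib]
    simp
  have h2 : ∀ i : Fin d, ∑ s : Bool, latticeChar d (rwStep d i s a - b) θ =
      latticeChar d (a - b) θ * (2 * ((Real.cos (θ i) : ℝ) : ℂ)) := by
    intro i
    simp only [rwStep, Fintype.sum_bool, if_true, Bool.false_eq_true, if_false]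
    rw [h, h, ← mul_add, Complex.ofReal_cos, Complex.two_cos]
    push_cast
    ring_nf
  simp_rw [h2, ← Finset.mul_sum]
  unfold stepChar
  rcases Nat.eq_zero_or_pos d with rfl | hd
  · simp
  have : (d : ℂ) ≠ 0 := by exact_mod_cast hd.ne'
  push_cast
  field_simp

/-- Fourier representation of the transition probabilities. -/
lemma rwP_mul_two_pi_pow (d m : ℕ) (a b : Zd d) :
    (rwP d m a b : ℂ) * (2 * (π : ℂ)) ^ d =
      ∫ θ, latticeChar d (a - b) θ * ((stepChar d θ : ℝ) : ℂ) ^ m ∂(torusMeasure d) := by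
  induction m generalizing a with
  | zero =>
    simp only [pow_zero, mul_one, integral_latticeChar, sub_eq_zero, rwP]
    split_ifs <;> simp
  | succ m ih =>
    have h : ∀ θ, latticeChar d (a - b) θ * ((stepChar d θ : ℝ) : ℂ) ^ (m + 1) =
        (1 / (2 * (d : ℂ))) * ∑ i : Fin d, ∑ s : Bool,
          latticeChar d (rwStep d i s a - b) θ * ((stepChar d θ : ℝ) : ℂ) ^ m := by
      intro θ
      rw [pow_succ', ← mul_assoc, ← sum_latticeChar_rwStep]
      simp_rw [← Finset.sum_mul]
      ring
    simp_rw [h]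
    rw [integral_const_mul, integral_finsetSum _ fun i _ =>
      integrable_finsetSum _ fun s _ => integrable_latticeChar_mul_pow d m _]
    simp_rw [integral_finsetSum Finset.univ fun (s : Bool) _ =>
      integrable_latticeChar_mul_pow d m (rwStep d _ s a - b), ← ih, ← Finset.sum_mul]
    simp only [rwP]
    push_cast
    ring

lemma rwP_self (d m : ℕ) (a : Zd d) : rwP d m a a = rwP d m 0 0 := by
  have h := (rwP_mul_two_pi_pow d m a a).trans
    ((by simp : _ = _).trans (rwP_mul_two_pi_pow d m 0 0).symm)
  have hp : (2 * (π : ℂ)) ^ d ≠ 0 := pow_ne_zero _ (by simp [Real.pi_ne_zero])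
  exact_mod_cast mul_right_cancel₀ hp h

lemma exp_neg_mul_sin_sq_le (c t : ℝ) (hc : 0 ≤ c) (ht : t ∈ Set.Ioc (-π) π) :
    Real.exp (-c * Real.sin t ^ 2) ≤
      Real.exp (-(c * (2 / π) ^ 2) * t ^ 2) + Real.exp (-(c * (2 / π) ^ 2) * (t - π) ^ 2) +
        Real.exp (-(c * (2 / π) ^ 2) * (t + π) ^ 2) := by
  have key : ∀ s : ℝ, |s| ≤ π / 2 →
      Real.exp (-c * Real.sin s ^ 2) ≤ Real.exp (-(c * (2 / π) ^ 2) * s ^ 2) := by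
    intro s hs
    rw [Real.exp_le_exp]
    have h := Real.mul_abs_le_abs_sin hs
    have h2 : (2 / π * |s|) ^ 2 ≤ |Real.sin s| ^ 2 :=
      pow_le_pow_left₀ (by positivity) h 2
    rw [mul_pow, sq_abs, sq_abs] at h2
    nlinarith
  have p1 := Real.exp_pos (-(c * (2 / π) ^ 2) * t ^ 2)
  have p2 := Real.exp_pos (-(c * (2 / π) ^ 2) * (t - π) ^ 2)
  have p3 := Real.exp_pos (-(c * (2 / π) ^ 2) * (t + π) ^ 2)
  rcases le_or_gt |t| (π / 2) with h | h
  · linarith [key t h]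
  · rcases lt_abs.mp h with h | h
    · have := key (t - π) (abs_le.mpr ⟨by linarith, by linarith [ht.2, Real.pi_pos]⟩)
      rw [Real.sin_sub_pi, neg_sq] at this
      linarith
    · have := key (t + π) (abs_le.mpr ⟨by linarith [ht.1, Real.pi_pos], by linarith⟩)
      rw [Real.sin_add_pi, neg_sq] at this
      linarith

lemma integral_exp_neg_mul_sin_sq_le (c : ℝ) (hc : 0 < c) :
    ∫ t in Set.Ioc (-π) π, Real.exp (-c * Real.sin t ^ 2) ≤
      3 * √(π / (c * (2 / π) ^ 2)) := by
  have hb : 0 < c * (2 / π) ^ 2 := by have := Real.pi_pos; positivity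
  set b := c * (2 / π) ^ 2 with hb_def
  have i1 := integrable_exp_neg_mul_sq hb
  have i2 := i1.comp_sub_right π
  have i3 := i1.comp_add_right π
  have hsum := (i1.add i2).add i3
  calc ∫ t in Set.Ioc (-π) π, Real.exp (-c * Real.sin t ^ 2)
      ≤ ∫ t in Set.Ioc (-π) π, (Real.exp (-b * t ^ 2) + Real.exp (-b * (t - π) ^ 2) +
          Real.exp (-b * (t + π) ^ 2)) := by
        refine setIntegral_mono_on ?_ hsum.integrableOn measurableSet_Ioc
          fun t ht => exp_neg_mul_sin_sq_le c t hc.le ht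
        exact (Continuous.integrableOn_Icc (by fun_prop)).mono_set Set.Ioc_subset_Icc_self
    _ ≤ ∫ t, (Real.exp (-b * t ^ 2) + Real.exp (-b * (t - π) ^ 2) +
          Real.exp (-b * (t + π) ^ 2)) :=
        setIntegral_le_integral hsum (ae_of_all _ fun t => by positivity)
    _ = 3 * √(π / b) := by
        have e1 := integral_add (i1.add i2) i3
        have e2 := integral_add i1 i2
        simp only [Pi.add_apply] at e1
        rw [e1, e2,
          integral_sub_right_eq_self (fun t => Real.exp (-b * t ^ 2)) π,
          integral_add_right_eq_self (fun t => Real.exp (-b * t ^ 2)) π, integral_gaussian]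
        ring

lemma rwP_nonneg (d m : ℕ) (a b : Zd d) : 0 ≤ rwP d m a b := by
  induction m generalizing a with
  | zero => unfold rwP; split_ifs <;> norm_num
  | succ m ih =>
    unfold rwP
    exact mul_nonneg (by positivity)
      (Finset.sum_nonneg fun i _ => Finset.sum_nonneg fun s _ => ih _)

/-- Heat kernel upper bound of order `m^{-d/2}`. -/
lemma rwP_le_heat_kernel (d m : ℕ) (hd : 0 < d) (hm : 0 < m) (a b : Zd d) :
    rwP d m a b ≤ (3 * √(π / ((m / (2 * d)) * (2 / π) ^ 2)) / (2 * π)) ^ d := by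
  have hd' : (0 : ℝ) < d := by exact_mod_cast hd
  have hm' : (0 : ℝ) < m := by exact_mod_cast hm
  have hpi := Real.pi_pos
  have hb : ∀ θ : Fin d → ℝ, ‖latticeChar d (a - b) θ * ((stepChar d θ : ℝ) : ℂ) ^ m‖ ≤
      ∏ i, (fun t => Real.exp (-((m : ℝ) / (2 * d)) * Real.sin t ^ 2)) (θ i) := by
    intro θ
    rw [norm_mul, norm_latticeChar, norm_pow, Complex.norm_real, one_mul]
    refine (pow_le_pow_left₀ (norm_nonneg _) (abs_stepChar_le_exp d hd θ) m).trans_eq ?_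
    rw [← Finset.prod_pow]
    refine Finset.prod_congr rfl fun i _ => ?_
    rw [← Real.exp_nat_mul]
    congr 1
    ring
  have hcont : Continuous fun θ : Fin d → ℝ =>
      ∏ i, (fun t => Real.exp (-((m : ℝ) / (2 * d)) * Real.sin t ^ 2)) (θ i) := by fun_prop
  have hinteg : Integrable (fun θ : Fin d → ℝ =>
      ∏ i, (fun t => Real.exp (-((m : ℝ) / (2 * d)) * Real.sin t ^ 2)) (θ i))
      (torusMeasure d) := by
    refine Integrable.of_bound (C := 1) hcont.aestronglyMeasurable (ae_of_all _ fun θ => ?_)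
    rw [Real.norm_of_nonneg (Finset.prod_nonneg fun _ _ => by positivity)]
    refine Finset.prod_le_one (fun _ _ => by positivity) fun i _ => ?_
    rw [Real.exp_le_one_iff, neg_mul]
    have : 0 ≤ (m : ℝ) / (2 * d) * Real.sin (θ i) ^ 2 := by positivity
    linarith
  have h1 : rwP d m a b * (2 * π) ^ d ≤ (3 * √(π / ((m / (2 * d)) * (2 / π) ^ 2))) ^ d := by
    calc rwP d m a b * (2 * π) ^ d = ‖(rwP d m a b : ℂ) * (2 * (π : ℂ)) ^ d‖ := by
          rw [norm_mul, norm_pow, norm_mul, Complex.norm_real, Complex.norm_real,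
            Real.norm_of_nonneg (rwP_nonneg d m a b), Real.norm_of_nonneg hpi.le]
          simp
      _ ≤ ∫ θ, ∏ i, (fun t => Real.exp (-((m : ℝ) / (2 * d)) * Real.sin t ^ 2)) (θ i)
            ∂(torusMeasure d) := by
          rw [rwP_mul_two_pi_pow]
          exact norm_integral_le_of_norm_le hinteg (ae_of_all _ hb)
      _ = (∫ t in Set.Ioc (-π) π, Real.exp (-((m : ℝ) / (2 * d)) * Real.sin t ^ 2)) ^ d := by
          unfold torusMeasure
          rw [integral_fintype_prod_eq_pow
            (fun t => Real.exp (-((m : ℝ) / (2 * d)) * Real.sin t ^ 2)), Fintype.card_fin]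
      _ ≤ _ := by
          refine pow_le_pow_left₀ (integral_nonneg fun t => by positivity) ?_ d
          exact integral_exp_neg_mul_sin_sq_le _ (by positivity)
  rw [div_pow, le_div_iff₀ (by positivity)]
  exact h1

lemma exists_rwP_le_rpow (d : ℕ) (hd : 3 ≤ d) :
    ∃ C : ℝ, 0 < C ∧ ∀ (m : ℕ), 0 < m → ∀ a b : Zd d,
      rwP d m a b ≤ C * (m : ℝ) ^ (-(3 / 2) : ℝ) := by
  have hpi := Real.pi_pos
  have hd' : (0 : ℝ) < d := by exact_mod_cast (by omega : 0 < d)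
  set K : ℝ := 3 * √(π / ((1 / (2 * d)) * (2 / π) ^ 2)) / (2 * π) with hK
  have hKpos : 0 < K := by positivity
  refine ⟨K ^ d, by positivity, fun m hm a b => ?_⟩
  have hm' : (1 : ℝ) ≤ m := by exact_mod_cast hm
  have hm0 : (0 : ℝ) < m := by linarith
  refine (rwP_le_heat_kernel d m (by omega) hm a b).trans ?_
  have h : 3 * √(π / ((m / (2 * d)) * (2 / π) ^ 2)) / (2 * π) =
      K * (m : ℝ) ^ (-(1 / 2) : ℝ) := by
    have : π / ((m / (2 * d)) * (2 / π) ^ 2) = π / ((1 / (2 * d)) * (2 / π) ^ 2) * (m : ℝ)⁻¹ := by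
      field_simp
    rw [this, Real.sqrt_mul (by positivity), Real.sqrt_inv, Real.rpow_neg hm0.le,
      ← Real.sqrt_eq_rpow, hK]
    ring
  rw [h, mul_pow]
  gcongr
  rw [← Real.rpow_natCast, ← Real.rpow_mul hm0.le]
  refine Real.rpow_le_rpow_of_exponent_le hm' ?_
  have : (3 : ℝ) ≤ d := by exact_mod_cast hd
  linarith

lemma rwPIn_nonneg (d : ℕ) (Λ : Set (Zd d)) (m : ℕ) (a b : Zd d) : 0 ≤ rwPIn d Λ m a b := by
  induction m generalizing a with
  | zero => unfold rwPIn; split_ifs <;> norm_num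
  | succ m ih =>
    unfold rwPIn
    split_ifs
    · exact mul_nonneg (by positivity)
        (Finset.sum_nonneg fun i _ => Finset.sum_nonneg fun s _ => ih _)
    · exact le_rfl

lemma rwPIn_le_rwP (d : ℕ) (Λ : Set (Zd d)) (m : ℕ) (a b : Zd d) :
    rwPIn d Λ m a b ≤ rwP d m a b := by
  induction m generalizing a with
  | zero =>
    unfold rwPIn rwP
    split_ifs with h1 h2 h2
    · exact le_rfl
    · exact absurd h1.1 h2
    · exact zero_le_one
    · exact le_rfl
  | succ m ih =>
    have h0 := rwP_nonneg d (m + 1) a b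
    unfold rwPIn
    split_ifs
    · unfold rwP
      gcongr
      exact ih _
    · exact h0

/-- The killed and the free walk agree as long as the walk cannot have left `Λ`. -/
lemma rwPIn_eq_rwP (d : ℕ) (Λ : Set (Zd d)) (m : ℕ) (a b : Zd d)
    (h : ∀ c : Zd d, (∀ i, |a i - c i| ≤ m) → c ∈ Λ) :
    rwPIn d Λ m a b = rwP d m a b := by
  induction m generalizing a with
  | zero =>
    have ha : a ∈ Λ := h a (by simp)
    simp [rwPIn, rwP, ha]
  | succ m ih =>
    have ha : a ∈ Λ := h a (fun i => by rw [sub_self, abs_zero]; positivity)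
    unfold rwPIn rwP
    rw [if_pos ha]
    congr 1
    refine Finset.sum_congr rfl fun i _ => Finset.sum_congr rfl fun s _ => ih _ fun c hc => h c ?_
    intro j
    have hj := hc j
    unfold rwStep at hj
    rw [abs_le] at hj ⊢
    push_cast
    by_cases hji : j = i
    · subst hji
      rw [Function.update_self] at hj
      split_ifs at hj <;> omega
    · rw [Function.update_of_ne hji] at hj
      omega

lemma summable_rwP (d : ℕ) (hd : 3 ≤ d) (a b : Zd d) : Summable fun m => rwP d m a b := by
  obtain ⟨C, hC, h⟩ := exists_rwP_le_rpow d hd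
  rw [← summable_nat_add_iff 1]
  refine Summable.of_nonneg_of_le (fun m => rwP_nonneg d _ a b) (fun m => h (m + 1) (by omega) a b)
    (Summable.mul_left C ?_)
  exact (summable_nat_add_iff 1).mpr (Real.summable_nat_rpow.mpr (by norm_num))

lemma one_le_green (d : ℕ) (hd : 3 ≤ d) : 1 ≤ green d 0 0 := by
  have h := (summable_rwP d hd 0 0).le_tsum 0 (fun m _ => rwP_nonneg d m 0 0)
  simpa [green, rwP] using h

lemma greenIn_self_le_green (d : ℕ) (hd : 3 ≤ d) (Λ : Set (Zd d)) (a : Zd d) :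
    greenIn d Λ a a ≤ green d 0 0 := by
  unfold greenIn green
  have hs := summable_rwP d hd a a
  simp_rw [← rwP_self d _ a]
  exact (Summable.of_nonneg_of_le (fun m => rwPIn_nonneg d Λ m a a)
    (fun m => rwPIn_le_rwP d Λ m a a) hs).tsum_le_tsum (fun m => rwPIn_le_rwP d Λ m a a) hs

/-- The diagonal Dirichlet Green's function at distance `r` from the boundary differs from
`g(0)` by at most a constant times `r^{-1/4}`. -/
lemma exists_green_sub_greenIn_le (d : ℕ) (hd : 3 ≤ d) :
    ∃ C : ℝ, 0 < C ∧ ∀ (Λ : Set (Zd d)) (a : Zd d) (r : ℝ), 0 < r →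
      (∀ b ∉ Λ, r < distInf d a b) →
      green d 0 0 - greenIn d Λ a a ≤ C * r ^ (-(1 / 4) : ℝ) := by
  obtain ⟨C, hC, h⟩ := exists_rwP_le_rpow d hd
  have hsum : Summable fun m : ℕ => (m : ℝ) ^ (-(5 / 4) : ℝ) :=
    Real.summable_nat_rpow.mpr (by norm_num)
  refine ⟨C * (∑' m : ℕ, (m : ℝ) ^ (-(5 / 4) : ℝ) + 1), ?_, fun Λ a r hr hb => ?_⟩
  · have : 0 ≤ ∑' m : ℕ, (m : ℝ) ^ (-(5 / 4) : ℝ) := tsum_nonneg fun m => by positivity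
    positivity
  have hs := summable_rwP d hd a a
  have hs' : Summable fun m => rwPIn d Λ m a a :=
    Summable.of_nonneg_of_le (fun m => rwPIn_nonneg d Λ m a a)
      (fun m => rwPIn_le_rwP d Λ m a a) hs
  unfold greenIn green
  simp_rw [← rwP_self d _ a]
  rw [← hs.tsum_sub hs']
  have hterm : ∀ m : ℕ, rwP d m a a - rwPIn d Λ m a a ≤
      C * r ^ (-(1 / 4) : ℝ) * (m : ℝ) ^ (-(5 / 4) : ℝ) := by
    intro m
    rcases le_or_gt (m : ℝ) r with hm | hm
    · rw [rwPIn_eq_rwP, sub_self]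
      · positivity
      · intro c hc
        by_contra hcΛ
        have hlt := hm.trans_lt (hb c hcΛ)
        unfold distInf at hlt
        have hlt' := Nat.cast_lt.mp hlt
        obtain ⟨i, -, hi⟩ := Finset.lt_sup_iff.mp hlt'
        have := hc i
        rw [Int.abs_eq_natAbs] at this
        omega
    · have hm0 : (0 : ℝ) < m := hr.trans hm
      have h1 := h m (by exact_mod_cast hm0) a a
      have h2 := rwPIn_nonneg d Λ m a a
      have h3 : (m : ℝ) ^ (-(3 / 2) : ℝ) = (m : ℝ) ^ (-(1 / 4) : ℝ) * (m : ℝ) ^ (-(5 / 4) : ℝ) := by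
        rw [← Real.rpow_add hm0]; norm_num
      have h4 : (m : ℝ) ^ (-(1 / 4) : ℝ) ≤ r ^ (-(1 / 4) : ℝ) :=
        Real.rpow_le_rpow_of_nonpos hr hm.le (by norm_num)
      calc rwP d m a a - rwPIn d Λ m a a ≤ C * (m : ℝ) ^ (-(3 / 2) : ℝ) := by linarith
        _ = C * (m : ℝ) ^ (-(1 / 4) : ℝ) * (m : ℝ) ^ (-(5 / 4) : ℝ) := by rw [h3]; ring
        _ ≤ _ := by gcongr
  refine ((hs.sub hs').tsum_le_tsum hterm (hsum.mul_left _)).trans ?_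
  rw [tsum_mul_left]
  have : 0 < C * r ^ (-(1 / 4) : ℝ) := by positivity
  nlinarith

lemma hasDerivAt_neg_exp_neg_sq_half (s : ℝ) :
    HasDerivAt (fun s : ℝ => -Real.exp (-s ^ 2 / 2)) (s * Real.exp (-s ^ 2 / 2)) s := by
  have h : HasDerivAt (fun s : ℝ => -s ^ 2 / 2) (-s) s := by
    refine (((hasDerivAt_pow 2 s).neg).div_const 2).congr_deriv ?_
    norm_num
    ring
  exact h.exp.neg.congr_deriv (by ring)

lemma tendsto_exp_neg_sq_half : Tendsto (fun s : ℝ => Real.exp (-s ^ 2 / 2)) atTop (nhds 0) := by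
  have h : Tendsto (fun s : ℝ => s ^ 2 / 2) atTop atTop :=
    (tendsto_pow_atTop two_ne_zero).atTop_div_const two_pos
  refine (Real.tendsto_exp_neg_atTop_nhds_zero.comp h).congr fun s => ?_
  simp [neg_div]

lemma integrable_exp_neg_sq_half : Integrable fun s : ℝ => Real.exp (-s ^ 2 / 2) := by
  refine (integrable_exp_neg_mul_sq (b := 1 / 2) (by norm_num)).congr (ae_of_all _ fun s => ?_)
  simp only
  congr 1
  ring

lemma integral_Ioi_exp_neg_sq_half_le (t : ℝ) (ht : 0 < t) :
    ∫ s in Set.Ioi t, Real.exp (-s ^ 2 / 2) ≤ Real.exp (-t ^ 2 / 2) / t := by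
  have htend : Tendsto (fun s : ℝ => -Real.exp (-s ^ 2 / 2)) atTop (nhds 0) := by
    simpa using tendsto_exp_neg_sq_half.neg
  have hpos : ∀ s ∈ Set.Ioi t, 0 ≤ s * Real.exp (-s ^ 2 / 2) := fun s hs =>
    mul_nonneg (ht.trans hs).le (Real.exp_pos _).le
  have hi := integrableOn_Ioi_deriv_of_nonneg'
    (fun s _ => hasDerivAt_neg_exp_neg_sq_half s) hpos htend
  have he := integral_Ioi_of_hasDerivAt_of_nonneg'
    (fun s _ => hasDerivAt_neg_exp_neg_sq_half s) hpos htend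
  rw [le_div_iff₀ ht]
  calc (∫ s in Set.Ioi t, Real.exp (-s ^ 2 / 2)) * t
      = ∫ s in Set.Ioi t, Real.exp (-s ^ 2 / 2) * t := (integral_mul_const _ _).symm
    _ ≤ ∫ s in Set.Ioi t, s * Real.exp (-s ^ 2 / 2) := by
        refine setIntegral_mono_on (integrable_exp_neg_sq_half.integrableOn.mul_const t) hi
          measurableSet_Ioi fun s hs => ?_
        rw [mul_comm]
        gcongr
        exact (Set.mem_Ioi.mp hs).le
    _ = Real.exp (-t ^ 2 / 2) := by rw [he]; ring

lemma le_integral_Ioi_exp_neg_sq_half (t : ℝ) (ht : 0 < t) :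
    Real.exp (-t ^ 2 / 2) / t ≤
      (1 + 1 / t ^ 2) * ∫ s in Set.Ioi t, Real.exp (-s ^ 2 / 2) := by
  have hderiv : ∀ s ∈ Set.Ici t, HasDerivAt (fun s : ℝ => -Real.exp (-s ^ 2 / 2) / s)
      ((1 + 1 / s ^ 2) * Real.exp (-s ^ 2 / 2)) s := by
    intro s hs
    have hs0 : s ≠ 0 := (ht.trans_le hs).ne'
    refine ((hasDerivAt_neg_exp_neg_sq_half s).div (hasDerivAt_id' s) hs0).congr_deriv ?_
    field_simp
    ring
  have hpos : ∀ s ∈ Set.Ioi t, 0 ≤ (1 + 1 / s ^ 2) * Real.exp (-s ^ 2 / 2) := fun s _ => by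
    positivity
  have htend : Tendsto (fun s : ℝ => -Real.exp (-s ^ 2 / 2) / s) atTop (nhds 0) := by
    have := tendsto_exp_neg_sq_half.neg.mul tendsto_inv_atTop_zero
    simpa [div_eq_mul_inv] using this
  have hi := integrableOn_Ioi_deriv_of_nonneg' hderiv hpos htend
  have he := integral_Ioi_of_hasDerivAt_of_nonneg' hderiv hpos htend
  calc Real.exp (-t ^ 2 / 2) / t
      = ∫ s in Set.Ioi t, (1 + 1 / s ^ 2) * Real.exp (-s ^ 2 / 2) := by rw [he]; ring
    _ ≤ ∫ s in Set.Ioi t, (1 + 1 / t ^ 2) * Real.exp (-s ^ 2 / 2) := by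
        refine setIntegral_mono_on hi (integrable_exp_neg_sq_half.integrableOn.const_mul _)
          measurableSet_Ioi fun s hs => ?_
        have : t ≤ s := (Set.mem_Ioi.mp hs).le
        gcongr
    _ = _ := integral_const_mul _ _

lemma gaussianReal_Ioi_eq (t : ℝ) :
    (gaussianReal 0 1).real (Set.Ioi t) =
      (∫ s in Set.Ioi t, Real.exp (-s ^ 2 / 2)) / √(2 * π) := by
  rw [measureReal_def, gaussianReal_apply_eq_integral 0 one_ne_zero, ENNReal.toReal_ofReal
    (integral_nonneg fun s => gaussianPDFReal_nonneg 0 1 s), ← integral_div]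
  refine integral_congr_ae (ae_of_all _ fun s => ?_)
  simp [gaussianPDFReal]
  ring

/-- Mills' ratio: the standard Gaussian tail at `t` is asymptotic to `φ(t) / t`. -/
lemma tendsto_mills_ratio :
    Tendsto (fun t : ℝ => (gaussianReal 0 1).real (Set.Ioi t) *
      (t * √(2 * π) * Real.exp (t ^ 2 / 2))) atTop (nhds 1) := by
  have hpi : 0 < √(2 * π) := by have := Real.pi_pos; positivity
  have hlow : Tendsto (fun t : ℝ => 1 / (1 + 1 / t ^ 2)) atTop (nhds 1) := by
    have h1 : Tendsto (fun t : ℝ => 1 / t ^ 2) atTop (nhds 0) := by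
      simpa using (tendsto_pow_neg_atTop (𝕜 := ℝ) (n := 2) two_ne_zero)
    have h2 := (h1.const_add 1).inv₀ (by norm_num)
    simpa using h2
  have heq : ∀ t : ℝ, (gaussianReal 0 1).real (Set.Ioi t) *
      (t * √(2 * π) * Real.exp (t ^ 2 / 2)) =
      (∫ s in Set.Ioi t, Real.exp (-s ^ 2 / 2)) * (t * Real.exp (t ^ 2 / 2)) := by
    intro t
    rw [gaussianReal_Ioi_eq]
    field_simp
  have hexp : ∀ t : ℝ, Real.exp (-t ^ 2 / 2) * Real.exp (t ^ 2 / 2) = 1 := by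
    intro t
    rw [← Real.exp_add, ← Real.exp_zero]
    congr 1
    ring
  refine tendsto_of_tendsto_of_tendsto_of_le_of_le' hlow tendsto_const_nhds ?_ ?_
  · filter_upwards [eventually_gt_atTop 0] with t ht
    have h := le_integral_Ioi_exp_neg_sq_half t ht
    rw [heq, div_le_iff₀ (by positivity)]
    rw [div_le_iff₀ ht] at h
    have := mul_le_mul_of_nonneg_right h (Real.exp_pos (t ^ 2 / 2)).le
    rw [hexp] at this
    linarith
  · filter_upwards [eventually_gt_atTop 0] with t ht
    have h := integral_Ioi_exp_neg_sq_half_le t ht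
    rw [heq]
    rw [le_div_iff₀ ht] at h
    have := mul_le_mul_of_nonneg_right h (Real.exp_pos (t ^ 2 / 2)).le
    rw [hexp] at this
    linarith

lemma gaussianReal_Ioi_toNNReal (v u : ℝ) (hv : 0 < v) :
    (gaussianReal 0 v.toNNReal).real (Set.Ioi u) =
      (gaussianReal 0 1).real (Set.Ioi (u / √v)) := by
  have hs : 0 < √v := Real.sqrt_pos.mpr hv
  have hmap : gaussianReal 0 v.toNNReal = (gaussianReal 0 1).map (fun x => √v * x) := by
    rw [gaussianReal_map_const_mul, mul_zero, mul_one]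
    congr 1
    ext
    simp [hv.le, Real.sq_sqrt]
  rw [hmap, map_measureReal_apply (by fun_prop) measurableSet_Ioi]
  congr 1
  ext z
  simp [div_lt_iff₀ hs, mul_comm]

lemma gaussianReal_Ioi_mono (u v w : ℝ) (hu : 0 ≤ u) (hv : 0 < v) (hvw : v ≤ w) :
    (gaussianReal 0 1).real (Set.Ioi (u / √v)) ≤
      (gaussianReal 0 1).real (Set.Ioi (u / √w)) := by
  refine measureReal_mono (Set.Ioi_subset_Ioi ?_)
  have := Real.sqrt_pos.mpr hv
  gcongr

/-- The centering `b_N` of unit variance as a function of `L = log N`. -/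
noncomputable def centering (L : ℝ) : ℝ :=
  √(2 * L) - (Real.log L + Real.log (4 * π)) / (2 * √(2 * L))

lemma bN_eq_centering (g : ℝ) (N : ℕ) : bN g N = √g * centering (Real.log N) := rfl

lemma tendsto_log_add_const_sq_div (c : ℝ) :
    Tendsto (fun L : ℝ => (Real.log L + c) ^ 2 / L) atTop (nhds 0) := by
  have h := Real.isLittleO_log_id_atTop
  have hc : (fun L : ℝ => Real.log L + c) =o[atTop] fun L : ℝ => L ^ (1 / 2 : ℝ) :=
    (isLittleO_log_rpow_atTop (by norm_num)).add
      (Asymptotics.isLittleO_const_left.mpr (Or.inr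
        (tendsto_norm_atTop_atTop.comp (tendsto_rpow_atTop (by norm_num)))))
  have h2 := (hc.pow two_pos).tendsto_div_nhds_zero
  refine h2.congr' ?_
  filter_upwards [eventually_gt_atTop 0] with L hL
  rw [← Real.sqrt_eq_rpow, Real.sq_sqrt hL.le]

lemma tendsto_centering_sq_sub :
    Tendsto (fun L : ℝ => centering L ^ 2 - (2 * L - Real.log L - Real.log (4 * π)))
      atTop (nhds 0) := by
  have h := (tendsto_log_add_const_sq_div (Real.log (4 * π))).div_const 8
  rw [zero_div] at h
  refine h.congr' ?_
  filter_upwards [eventually_gt_atTop 0] with L hL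
  have hs : 0 < √(2 * L) := Real.sqrt_pos.mpr (by positivity)
  have hsq : √(2 * L) ^ 2 = 2 * L := Real.sq_sqrt (by positivity)
  have hexp : centering L ^ 2 = √(2 * L) ^ 2 - (Real.log L + Real.log (4 * π)) +
      (Real.log L + Real.log (4 * π)) ^ 2 / (4 * √(2 * L) ^ 2) := by
    unfold centering
    field_simp
    ring
  rw [hexp, hsq]
  field_simp
  ring

lemma tendsto_centering_atTop : Tendsto centering atTop atTop := by
  have h1 : Tendsto (fun L : ℝ => √(2 * L)) atTop atTop :=
    Real.tendsto_sqrt_atTop.comp (tendsto_id.const_mul_atTop two_pos)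
  have h2 : Tendsto (fun L : ℝ => (Real.log L + Real.log (4 * π)) / (2 * √(2 * L)))
      atTop (nhds 0) := by
    have h := (tendsto_log_add_const_sq_div (Real.log (4 * π))).div_const 8
    rw [zero_div] at h
    have h3 := (Real.continuous_sqrt.tendsto 0).comp h
    rw [Real.sqrt_zero] at h3
    rw [tendsto_zero_iff_abs_tendsto_zero]
    refine h3.congr' ?_
    filter_upwards [eventually_gt_atTop 0] with L hL
    rw [Function.comp_apply, Function.comp_apply, ← Real.sqrt_sq_eq_abs, div_pow, mul_pow,
      Real.sq_sqrt (by positivity), div_div]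
    ring_nf
  exact (h1.atTop_add h2.neg).congr fun L => by unfold centering; ring

lemma tendsto_two_mul_sub_log_div (c : ℝ) :
    Tendsto (fun L : ℝ => (2 * L - Real.log L - c) / (2 * L)) atTop (nhds 1) := by
  have h1 : Tendsto (fun L : ℝ => Real.log L / L) atTop (nhds 0) :=
    Real.isLittleO_log_id_atTop.tendsto_div_nhds_zero
  have h2 : Tendsto (fun L : ℝ => c / L) atTop (nhds 0) := tendsto_id.const_div_atTop c
  have h := ((h1.add h2).div_const 2).const_sub 1
  simp only [add_zero, zero_div, sub_zero] at h
  refine h.congr' ?_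
  filter_upwards [eventually_gt_atTop 0] with L hL
  field_simp
  ring

/-- Exponential-scale asymptotics of the threshold: if `t² = 2L - log L - log 4π + 2x + o(1)`
then the density `φ(t)/t` is `exp(-L-x)` up to a factor tending to one. -/
lemma tendsto_exp_div_mills {ι : Type*} {l : Filter ι} {L t : ι → ℝ} (x : ℝ)
    (hL : Tendsto L l atTop) (ht0 : ∀ᶠ i in l, 0 < t i)
    (ht : Tendsto (fun i => t i ^ 2 - (2 * L i - Real.log (L i) - Real.log (4 * π) + 2 * x)) l
      (nhds 0)) :
    Tendsto (fun i => Real.exp (L i) / (t i * √(2 * π) * Real.exp (t i ^ 2 / 2))) l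
      (nhds (Real.exp (-x))) := by
  have hpi := Real.pi_pos
  have hratio : Tendsto (fun i => t i ^ 2 / (2 * L i)) l (nhds 1) := by
    have h1 := (tendsto_two_mul_sub_log_div (Real.log (4 * π) - 2 * x)).comp hL
    have h2 : Tendsto (fun i => (2 * L i)⁻¹) l (nhds 0) :=
      tendsto_inv_atTop_zero.comp (hL.const_mul_atTop two_pos)
    have h := h1.add (ht.mul h2)
    simp only [mul_zero, add_zero] at h
    refine h.congr fun i => ?_
    simp only [Function.comp_apply]
    ring
  have hlog : Tendsto (fun i => Real.log (t i ^ 2 / (2 * L i))) l (nhds 0) := by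
    have := (Real.continuousAt_log one_ne_zero).tendsto.comp hratio
    rwa [Real.log_one] at this
  have hexp := ((hlog.add ht).div_const 2).const_sub (-x)
  simp only [add_zero, zero_div, sub_zero] at hexp
  refine (Real.continuous_exp.continuousAt.tendsto.comp hexp).congr' ?_
  filter_upwards [ht0, hL.eventually_gt_atTop 0] with i hti hLi
  have hden : t i * √(2 * π) * Real.exp (t i ^ 2 / 2) =
      Real.exp (Real.log (t i) + Real.log (2 * π) / 2 + t i ^ 2 / 2) := by
    rw [Real.exp_add, Real.exp_add, Real.exp_log hti, ← Real.log_sqrt (by positivity),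
      Real.exp_log (by positivity)]
  rw [Function.comp_apply, hden, ← Real.exp_sub, Real.log_div (by positivity) (by positivity),
    Real.log_pow, Real.log_mul two_ne_zero hLi.ne', Real.log_mul two_ne_zero hpi.ne',
    Real.log_mul (by norm_num) hpi.ne', (by norm_num : (4 : ℝ) = 2 ^ 2), Real.log_pow]
  congr 1
  push_cast
  ring

lemma uN_eq (g : ℝ) (hg : 0 < g) (N : ℕ) (x : ℝ) :
    uN g N x = √g * (centering (Real.log N) + x / centering (Real.log N)) := by
  have hs : √g ≠ 0 := (Real.sqrt_pos.mpr hg).ne'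
  have hgg : g = √g * √g := (Real.mul_self_sqrt hg.le).symm
  unfold uN aN
  rw [bN_eq_centering]
  have : g / (√g * centering (Real.log N)) = √g / centering (Real.log N) := by
    rw [← mul_div_mul_left (√g) _ hs, ← hgg]
  rw [this]
  ring

lemma tendsto_uN_atTop {ι : Type*} {l : Filter ι} {N : ι → ℕ} (g : ℝ) (hg : 0 < g) (x : ℝ)
    (hN : Tendsto (fun i => Real.log (N i)) l atTop) :
    Tendsto (fun i => uN g (N i) x) l atTop := by
  simp_rw [uN_eq g hg]
  have h := tendsto_centering_atTop.comp hN
  exact (h.atTop_add (h.const_div_atTop x)).const_mul_atTop (Real.sqrt_pos.mpr hg)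

/-- The rescaled Gaussian tail at level `u_N(x)` converges to `exp(-x)`, provided the variance
approaches `g` faster than `1 / log N`. -/
lemma tendsto_mul_gaussianReal_Ioi_uN {ι : Type*} {l : Filter ι} {N : ι → ℕ} {v : ι → ℝ}
    (g : ℝ) (hg : 0 < g) (x : ℝ) (hN : Tendsto (fun i => Real.log (N i)) l atTop)
    (hv : Tendsto (fun i => (g - v i) * Real.log (N i)) l (nhds 0)) :
    Tendsto (fun i => (N i : ℝ) * (gaussianReal 0 1).real (Set.Ioi (uN g (N i) x / √(v i)))) l
      (nhds (Real.exp (-x))) := by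
  have hvg : Tendsto v l (nhds g) := by
    have h := (hv.mul (tendsto_inv_atTop_zero.comp hN)).const_sub g
    simp only [mul_zero, sub_zero] at h
    refine h.congr' ?_
    filter_upwards [hN.eventually_gt_atTop 0] with i hi
    simp only [Function.comp_apply]
    field_simp
    ring
  have hvpos : ∀ᶠ i in l, 0 < v i := hvg.eventually_const_lt hg
  have hsqrt : Tendsto (fun i => √(v i)) l (nhds √g) :=
    (Real.continuous_sqrt.tendsto g).comp hvg
  have hsg : 0 < √g := Real.sqrt_pos.mpr hg
  have htop : Tendsto (fun i => uN g (N i) x / √(v i)) l atTop := by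
    simp_rw [div_eq_mul_inv]
    exact (tendsto_uN_atTop g hg x hN).atTop_mul_pos (inv_pos.mpr hsg) (hsqrt.inv₀ hsg.ne')
  have hβ := tendsto_centering_atTop.comp hN
  have hw : Tendsto (fun i => (centering (Real.log (N i)) + x / centering (Real.log (N i))) ^ 2 -
      (2 * Real.log (N i) - Real.log (Real.log (N i)) - Real.log (4 * π) + 2 * x)) l
      (nhds 0) := by
    have h1 := tendsto_centering_sq_sub.comp hN
    have h2 := (hβ.const_div_atTop x).pow 2
    have h := h1.add h2
    simp only [ne_eq, OfNat.ofNat_ne_zero, not_false_eq_true, zero_pow, add_zero] at h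
    refine h.congr' ?_
    filter_upwards [hβ.eventually_gt_atTop 0] with i hi
    simp only [Function.comp_apply] at hi ⊢
    field_simp
    ring
  have hw' : Tendsto (fun i => (centering (Real.log (N i)) +
      x / centering (Real.log (N i))) ^ 2 / Real.log (N i)) l (nhds 2) := by
    have h1 := ((tendsto_two_mul_sub_log_div (Real.log (4 * π) - 2 * x)).comp hN).const_mul 2
    have h := h1.add (hw.mul (tendsto_inv_atTop_zero.comp hN))
    simp only [mul_zero, add_zero, mul_one] at h
    refine h.congr' ?_
    filter_upwards [hN.eventually_gt_atTop 0] with i hi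
    simp only [Function.comp_apply]
    field_simp
    ring
  have ht : Tendsto (fun i => (uN g (N i) x / √(v i)) ^ 2 -
      (2 * Real.log (N i) - Real.log (Real.log (N i)) - Real.log (4 * π) + 2 * x)) l
      (nhds 0) := by
    have h := hw.add ((hw'.mul hv).div hvg hg.ne')
    simp only [mul_zero, zero_div, add_zero, Pi.div_apply] at h
    refine h.congr' ?_
    filter_upwards [hvpos, hN.eventually_gt_atTop 0] with i hvi hLi
    rw [uN_eq g hg, div_pow, mul_pow, Real.sq_sqrt hg.le, Real.sq_sqrt hvi.le]
    generalize centering (Real.log (N i)) + x / centering (Real.log (N i)) = w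
    field_simp
    ring
  have h1 := tendsto_exp_div_mills x hN (htop.eventually_gt_atTop 0) ht
  have h2 := h1.mul (tendsto_mills_ratio.comp htop)
  rw [mul_one] at h2
  refine h2.congr' ?_
  filter_upwards [htop.eventually_gt_atTop 0, hN.eventually_gt_atTop 0] with i hti hLi
  have hNi : (0 : ℝ) < N i := by
    rcases Nat.eq_zero_or_pos (N i) with h0 | h0
    · simp [h0] at hLi
    · exact_mod_cast h0
  have hpi : 0 < √(2 * π) := by have := Real.pi_pos; positivity
  rw [Function.comp_apply, Real.exp_log hNi]
  generalize uN g (N i) x / √(v i) = t at hti ⊢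
  field_simp

lemma mem_VN_iff (d n : ℕ) (a : Zd d) : a ∈ VN d n ↔ ∀ i, 0 ≤ a i ∧ a i < n := by
  simp only [VN, Fintype.mem_piFinset, Finset.mem_Icc, Int.le_sub_one_iff]

lemma mem_bulk_iff (d n : ℕ) (δ : ℝ) (a : Zd d) :
    a ∈ bulk d n δ ↔ a ∈ VN d n ∧ ∀ i, δ * n < a i + 1 ∧ δ * n < n - a i := by
  simp only [bulk, Finset.mem_filter]
  refine and_congr_right fun ha => ⟨fun h i => ?_, fun h b hb => ?_⟩
  · have hai := (mem_VN_iff d n a).mp ha i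
    have hdist : ∀ e : ℤ, distInf d a (Function.update a i e) ≤ |((a i - e : ℤ) : ℝ)| := by
      intro e
      unfold distInf
      rw [← Int.cast_abs, Int.abs_eq_natAbs, Int.cast_natCast, Nat.cast_le]
      refine Finset.sup_le fun j _ => ?_
      by_cases hj : j = i
      · subst hj; simp
      · simp [hj]
    have hout : ∀ e : ℤ, (e < 0 ∨ (n : ℤ) ≤ e) → Function.update a i e ∉ VN d n := by
      intro e he hmem
      have := (mem_VN_iff d n _).mp hmem i
      rw [Function.update_self] at this
      omega
    have ha0 : (0 : ℝ) ≤ a i := by exact_mod_cast hai.1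
    have han : (a i : ℝ) < n := by exact_mod_cast hai.2
    constructor
    · have h1 := (h _ (hout (-1) (by omega))).trans_le (hdist (-1))
      push_cast at h1
      rw [abs_of_nonneg (by linarith)] at h1
      linarith
    · have h1 := (h _ (hout n (by omega))).trans_le (hdist n)
      push_cast at h1
      rw [abs_of_neg (by linarith)] at h1
      linarith
  · rw [mem_VN_iff] at hb
    push Not at hb
    obtain ⟨i, hi⟩ := hb
    have hai := (mem_VN_iff d n a).mp ha i
    have hle : |((a i - b i : ℤ) : ℝ)| ≤ distInf d a b := by
      unfold distInf
      rw [← Int.cast_abs, Int.abs_eq_natAbs, Int.cast_natCast, Nat.cast_le]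
      exact Finset.le_sup (f := fun i => (a i - b i).natAbs) (Finset.mem_univ i)
    refine lt_of_lt_of_le ?_ hle
    have hh := h i
    push_cast
    rcases lt_or_ge (b i) 0 with hb0 | hb0
    · have : (b i : ℝ) ≤ -1 := by exact_mod_cast (by omega : b i ≤ -1)
      exact lt_of_lt_of_le (by linarith) (le_abs_self _)
    · have : (n : ℝ) ≤ b i := by exact_mod_cast hi hb0
      exact lt_of_lt_of_le (by linarith) (neg_le_abs _)

open Classical in
/-- The admissible values of one coordinate of a point of `rectIdxBulk`. -/
noncomputable def coordIdx (n : ℕ) (δ lo hi : ℝ) : Finset ℤ :=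
  (Finset.Icc (0 : ℤ) ((n : ℤ) - 1)).filter fun k =>
    δ * n < k + 1 ∧ δ * n < n - k ∧ lo < (k : ℝ) / n ∧ (k : ℝ) / n ≤ hi

lemma rectIdxBulk_eq_piFinset (d n : ℕ) (δ : ℝ) (lo hi : Fin d → ℝ) (hn : 0 < n) :
    rectIdxBulk d n δ lo hi = Fintype.piFinset fun i => coordIdx n δ (lo i) (hi i) := by
  have hn' : (0 : ℝ) < n := by exact_mod_cast hn
  ext a
  simp only [rectIdxBulk, Finset.mem_filter, mem_bulk_iff, mem_VN_iff, rect, Set.mem_ofPred_eq,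
    Set.mem_inter_iff, Set.mem_Icc, Set.mem_Ioc, Fintype.mem_piFinset, coordIdx, Finset.mem_Icc,
    Int.le_sub_one_iff]
  constructor
  · rintro ⟨⟨h1, h2⟩, h3⟩ i
    exact ⟨h1 i, (h2 i).1, (h2 i).2, (h3 i).2⟩
  · intro h
    refine ⟨⟨fun i => (h i).1, fun i => ⟨(h i).2.1, (h i).2.2.1⟩⟩, fun i => ⟨?_, (h i).2.2.2⟩⟩
    have h0 : (0 : ℝ) ≤ a i := by exact_mod_cast (h i).1.1
    have h1 : (a i : ℝ) ≤ n := by exact_mod_cast (h i).1.2.le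
    exact ⟨by positivity, (div_le_one hn').mpr h1⟩

lemma card_coordIdx_le (n : ℕ) (δ lo hi : ℝ) (hn : 0 < n) :
    ((coordIdx n δ lo hi).card : ℝ) ≤ n * max 0 (min hi (1 - δ) - max lo δ) + 2 := by
  have hn' : (0 : ℝ) < n := by exact_mod_cast hn
  set A := max lo δ
  set B := min hi (1 - δ)
  have hsub : coordIdx n δ lo hi ⊆ Finset.Ioc ⌊n * A - 1⌋ ⌊n * B⌋ := by
    intro k hk
    simp only [coordIdx, Finset.mem_filter, Finset.mem_Icc, div_le_iff₀ hn', lt_div_iff₀ hn'] at hk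
    obtain ⟨_, h1, h2, h3, h4⟩ := hk
    rw [Finset.mem_Ioc, Int.floor_lt, Int.le_floor]
    constructor
    · rcases max_choice lo δ with h | h <;> simp only [A, h] <;> linarith
    · rcases min_choice hi (1 - δ) with h | h <;> simp only [B, h] <;> linarith
  refine (Nat.cast_le.mpr (Finset.card_le_card hsub)).trans ?_
  rw [Int.card_Ioc]
  have hle : (((⌊n * B⌋ - ⌊n * A - 1⌋).toNat : ℕ) : ℝ) ≤ max 0 (n * B - (n * A - 1) + 1) := by
    have h1 := Int.floor_le ((n : ℝ) * B)
    have h2 := Int.lt_floor_add_one ((n : ℝ) * A - 1)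
    rcases le_total (⌊n * B⌋ - ⌊n * A - 1⌋) 0 with h | h
    · rw [Int.toNat_of_nonpos h]; simp
    · have : (((⌊n * B⌋ - ⌊n * A - 1⌋).toNat : ℤ) : ℝ) = ((⌊n * B⌋ - ⌊n * A - 1⌋ : ℤ) : ℝ) := by
        rw [Int.toNat_of_nonneg h]
      rw [Int.cast_natCast] at this
      rw [this]
      push_cast
      exact le_max_of_le_right (by linarith)
  refine hle.trans (max_le (by positivity) ?_)
  have := mul_le_mul_of_nonneg_left (le_max_right 0 (B - A)) hn'.le
  linarith

lemma le_card_coordIdx (n : ℕ) (δ lo hi : ℝ) (hδ : 0 < δ) (hn : 0 < n) :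
    n * max 0 (min hi (1 - δ) - max lo δ) - 1 ≤ ((coordIdx n δ lo hi).card : ℝ) := by
  have hn' : (0 : ℝ) < n := by exact_mod_cast hn
  set A := max lo δ with hA
  set B := min hi (1 - δ) with hB
  have hsub : Finset.Ioc ⌊n * A⌋ (⌈n * B⌉ - 1) ⊆ coordIdx n δ lo hi := by
    intro k hk
    rw [Finset.mem_Ioc, Int.floor_lt, Int.le_sub_one_iff, Int.lt_ceil] at hk
    obtain ⟨h1, h2⟩ := hk
    have e1 : (n : ℝ) * lo ≤ n * A := by gcongr; exact le_max_left _ _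
    have e2 : (n : ℝ) * δ ≤ n * A := by gcongr; exact le_max_right _ _
    have e3 : (n : ℝ) * B ≤ n * hi := by gcongr; exact min_le_left _ _
    have e4 : (n : ℝ) * B ≤ n * (1 - δ) := by gcongr; exact min_le_right _ _
    have e5 : 0 < (n : ℝ) * δ := by positivity
    have k0 : 0 ≤ k := by
      have : (0 : ℝ) < k := by linarith
      exact_mod_cast this.le
    have kn : k < n := by
      have : (k : ℝ) < n := by linarith
      exact_mod_cast this
    simp only [coordIdx, Finset.mem_filter, Finset.mem_Icc, div_le_iff₀ hn', lt_div_iff₀ hn',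
      Int.le_sub_one_iff]
    exact ⟨⟨k0, kn⟩, by linarith, by linarith, by linarith, by linarith⟩
  refine le_trans ?_ (Nat.cast_le.mpr (Finset.card_le_card hsub))
  rw [Int.card_Ioc]
  have h1 := Int.floor_le ((n : ℝ) * A)
  have h2 := Int.le_ceil ((n : ℝ) * B)
  have h3 : (((⌈n * B⌉ - 1 - ⌊n * A⌋ : ℤ)) : ℝ) ≤
      (((⌈n * B⌉ - 1 - ⌊n * A⌋).toNat : ℤ) : ℝ) := Int.cast_le.mpr (Int.self_le_toNat _)
  rw [Int.cast_natCast] at h3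
  push_cast at h3
  rcases max_choice 0 (B - A) with h | h <;> rw [h]
  · have : (0 : ℝ) ≤ ((⌈n * B⌉ - 1 - ⌊n * A⌋).toNat : ℕ) := Nat.cast_nonneg _
    linarith
  · linarith

lemma tendsto_card_coordIdx_div (δ lo hi : ℝ) (hδ : 0 < δ) :
    Tendsto (fun n : ℕ => ((coordIdx n δ lo hi).card : ℝ) / n) atTop
      (nhds (max 0 (min hi (1 - δ) - max lo δ))) := by
  set ℓ := max 0 (min hi (1 - δ) - max lo δ)
  have h1 : Tendsto (fun n : ℕ => ℓ - 1 / (n : ℝ)) atTop (nhds ℓ) := by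
    simpa using (tendsto_const_div_atTop_nhds_zero_nat (1 : ℝ)).const_sub ℓ
  have h2 : Tendsto (fun n : ℕ => ℓ + 2 / (n : ℝ)) atTop (nhds ℓ) := by
    simpa using (tendsto_const_div_atTop_nhds_zero_nat (2 : ℝ)).const_add ℓ
  refine tendsto_of_tendsto_of_tendsto_of_le_of_le' h1 h2 ?_ ?_
  · filter_upwards [eventually_gt_atTop 0] with n hn
    have hn' : (0 : ℝ) < n := by exact_mod_cast hn
    rw [le_div_iff₀ hn', sub_mul, div_mul_cancel₀ _ hn'.ne', mul_comm]
    exact le_card_coordIdx n δ lo hi hδ hn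
  · filter_upwards [eventually_gt_atTop 0] with n hn
    have hn' : (0 : ℝ) < n := by exact_mod_cast hn
    rw [div_le_iff₀ hn', add_mul, div_mul_cancel₀ _ hn'.ne', mul_comm]
    exact card_coordIdx_le n δ lo hi hn

lemma volume_rect_inter_deltaBox (d : ℕ) (δ : ℝ) (hδ : 0 < δ) (lo hi : Fin d → ℝ) :
    (volume (rect d lo hi ∩ deltaBox d δ)).toReal =
      ∏ i, max 0 (min (hi i) (1 - δ) - max (lo i) δ) := by
  have hset : rect d lo hi ∩ deltaBox d δ =
      Set.pi Set.univ fun i => Set.Ioc (lo i) (hi i) ∩ Set.Icc δ (1 - δ) := by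
    ext t
    simp only [rect, deltaBox, Set.mem_inter_iff, Set.mem_ofPred_eq, Set.mem_Icc, Set.mem_Ioc,
      Set.mem_pi, Set.mem_univ, true_implies]
    constructor
    · rintro ⟨h1, h2⟩ i
      exact ⟨(h1 i).2, h2 i⟩
    · intro h
      exact ⟨fun i => ⟨⟨by linarith [(h i).2.1], by linarith [(h i).2.2]⟩, (h i).1⟩,
        fun i => (h i).2⟩
  rw [hset, volume_pi_pi, ENNReal.toReal_prod]
  refine Finset.prod_congr rfl fun i _ => ?_
  have hvol : volume (Set.Ioc (lo i) (hi i) ∩ Set.Icc δ (1 - δ)) =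
      ENNReal.ofReal (min (hi i) (1 - δ) - max (lo i) δ) := by
    apply le_antisymm
    · rw [← Real.volume_Icc]
      refine measure_mono fun t ht => ?_
      exact ⟨max_le ht.1.1.le ht.2.1, le_min ht.1.2 ht.2.2⟩
    · rw [← Real.volume_Ioc]
      refine measure_mono fun t ht => ?_
      obtain ⟨h1, h2⟩ := ht
      rw [max_lt_iff] at h1
      rw [le_min_iff] at h2
      exact ⟨⟨h1.1, h2.1⟩, h1.2.le, h2.2⟩
  rw [hvol, ENNReal.toReal_ofReal', max_comm]

/-- The number of bulk lattice points in the rectangle, divided by `n^d`, converges to the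
volume of its intersection with `[δ, 1-δ]^d`. -/
lemma tendsto_card_rectIdxBulk_div (d : ℕ) (δ : ℝ) (hδ : 0 < δ) (lo hi : Fin d → ℝ) :
    Tendsto (fun n : ℕ => ((rectIdxBulk d n δ lo hi).card : ℝ) / ((n ^ d : ℕ) : ℝ)) atTop
      (nhds (volume (rect d lo hi ∩ deltaBox d δ)).toReal) := by
  rw [volume_rect_inter_deltaBox d δ hδ]
  refine (tendsto_finsetProd Finset.univ fun i _ =>
    tendsto_card_coordIdx_div δ (lo i) (hi i) hδ).congr' ?_
  filter_upwards [eventually_gt_atTop 0] with n hn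
  rw [rectIdxBulk_eq_piFinset d n δ lo hi hn, Fintype.card_piFinset, Finset.prod_div_distrib]
  push_cast
  simp

lemma IsGaussianField.map_eq {Ω : Type*} [MeasurableSpace Ω] {P : Measure Ω} {d : ℕ}
    {G : Zd d → Zd d → ℝ} {φ : Zd d → Ω → ℝ} (h : IsGaussianField P d G φ) (a : Zd d) :
    Measure.map (φ a) P = gaussianReal 0 (G a a).toNNReal := by
  have h1 := h.2 (Finsupp.single a 1)
  rw [Finsupp.support_single a one_ne_zero] at h1
  simpa using h1

lemma IsGaussianField.measureReal_lt {Ω : Type*} [MeasurableSpace Ω] {P : Measure Ω} {d : ℕ}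
    {G : Zd d → Zd d → ℝ} {φ : Zd d → Ω → ℝ} (h : IsGaussianField P d G φ) (a : Zd d)
    (ha : 0 < G a a) (u : ℝ) :
    P.real {ω | u < φ a ω} = (gaussianReal 0 1).real (Set.Ioi (u / √(G a a))) := by
  rw [← gaussianReal_Ioi_toNNReal _ u ha, ← h.map_eq a,
    map_measureReal_apply (h.1 a) measurableSet_Ioi]
  rfl

lemma tendsto_log_natCast_pow (d : ℕ) (hd : 0 < d) :
    Tendsto (fun n : ℕ => Real.log ((n ^ d : ℕ) : ℝ)) atTop atTop := by
  have h := (Real.tendsto_log_atTop.comp tendsto_natCast_atTop_atTop).const_mul_atTop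
    (by exact_mod_cast hd : (0 : ℝ) < d)
  refine h.congr fun n => ?_
  simp

lemma tendsto_rpow_neg_mul_log_natCast_pow (d : ℕ) (C δ : ℝ) (hδ : 0 < δ) :
    Tendsto (fun n : ℕ => C * (δ * n) ^ (-(1 / 4) : ℝ) * Real.log ((n ^ d : ℕ) : ℝ)) atTop
      (nhds 0) := by
  have h := ((isLittleO_log_rpow_atTop (r := 1 / 4) (by norm_num)).tendsto_div_nhds_zero.comp
    tendsto_natCast_atTop_atTop).const_mul (C * δ ^ (-(1 / 4) : ℝ) * d)
  rw [mul_zero] at h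
  refine h.congr fun n => ?_
  rw [Real.mul_rpow hδ.le n.cast_nonneg, Real.rpow_neg n.cast_nonneg]
  push_cast
  rw [Real.log_pow]
  simp only [Function.comp_apply]
  ring

lemma tendsto_sum_bulk_tail
    (d : ℕ) (hd : 3 ≤ d) (δ : ℝ) (hδ : 0 < δ)
    {Ω : Type*} [MeasurableSpace Ω] (P : Measure Ω)
    (ψ : (n : ℕ) → Zd d → Ω → ℝ)
    (hψ : ∀ n, IsGaussianField P d (greenIn d (VN d n : Set (Zd d))) (ψ n))
    (lo hi : Fin d → ℝ) (x : ℝ) :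
    Tendsto
      (fun n : ℕ => ∑ a ∈ rectIdxBulk d n δ lo hi,
        P.real {ω | uN (green d 0 0) (n ^ d) x < ψ n a ω})
      atTop
      (nhds ((volume (rect d lo hi ∩ deltaBox d δ)).toReal * Real.exp (-x))) := by
  obtain ⟨C, hC, hgreen⟩ := exists_green_sub_greenIn_le d hd
  set g := green d 0 0 with hg_def
  have hg : 0 < g := lt_of_lt_of_le one_pos (one_le_green d hd)
  have hlog := tendsto_log_natCast_pow d (by omega)
  have hε := tendsto_rpow_neg_mul_log_natCast_pow d C δ hδ
  have hcard := tendsto_card_rectIdxBulk_div d δ hδ lo hi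
  set v : ℕ → ℝ := fun n => g - C * (δ * n) ^ (-(1 / 4) : ℝ) with hv_def
  have hlow := tendsto_mul_gaussianReal_Ioi_uN (N := fun n : ℕ => n ^ d) (v := v) g hg x hlog
    (hε.congr fun n => by simp only [hv_def, sub_sub_cancel])
  have hupp := tendsto_mul_gaussianReal_Ioi_uN (N := fun n : ℕ => n ^ d) (v := fun _ => g) g hg x
    hlog (by simp)
  have hvpos : ∀ᶠ n in atTop, 0 < v n := by
    have h0 : Tendsto (fun n : ℕ => C * (δ * n) ^ (-(1 / 4) : ℝ)) atTop (nhds 0) := by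
      have h := ((tendsto_rpow_neg_atTop (y := 1 / 4) (by norm_num)).comp
        (tendsto_natCast_atTop_atTop.const_mul_atTop hδ)).const_mul C
      rw [mul_zero] at h
      exact h
    filter_upwards [h0.eventually_lt_const hg] with n hn
    exact sub_pos.mpr hn
  have hterm : ∀ᶠ n : ℕ in atTop, ∀ a ∈ rectIdxBulk d n δ lo hi,
      (gaussianReal 0 1).real (Set.Ioi (uN g (n ^ d) x / √(v n))) ≤
          P.real {ω | uN g (n ^ d) x < ψ n a ω} ∧
        P.real {ω | uN g (n ^ d) x < ψ n a ω} ≤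
          (gaussianReal 0 1).real (Set.Ioi (uN g (n ^ d) x / √g)) := by
    filter_upwards [hvpos, (tendsto_uN_atTop g hg x hlog).eventually_ge_atTop 0,
      eventually_gt_atTop 0] with n hvn hun hn a ha
    have hn' : (0 : ℝ) < n := by exact_mod_cast hn
    have hbulk : a ∈ bulk d n δ := by
      simp only [rectIdxBulk, Finset.mem_filter] at ha
      exact ha.1
    have hdist : ∀ b ∉ (VN d n : Set (Zd d)), δ * n < distInf d a b := by
      simp only [bulk, Finset.mem_filter] at hbulk
      exact hbulk.2
    have h1 := hgreen _ a (δ * n) (by positivity) hdist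
    have h2 := greenIn_self_le_green d hd (VN d n : Set (Zd d)) a
    have h3 : v n ≤ greenIn d (VN d n : Set (Zd d)) a a := by
      simp only [hv_def]; linarith
    rw [(hψ n).measureReal_lt a (hvn.trans_le h3)]
    exact ⟨gaussianReal_Ioi_mono _ _ _ hun hvn h3,
      gaussianReal_Ioi_mono _ _ _ hun (hvn.trans_le h3) h2⟩
  have hpow : ∀ n : ℕ, 0 < n → ∀ q : ℝ,
      ((rectIdxBulk d n δ lo hi).card : ℝ) / ((n ^ d : ℕ) : ℝ) * (((n ^ d : ℕ) : ℝ) * q) =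
        (rectIdxBulk d n δ lo hi).card * q := by
    intro n hn q
    have : ((n ^ d : ℕ) : ℝ) ≠ 0 := by exact_mod_cast (pow_pos hn d).ne'
    field_simp
  refine tendsto_of_tendsto_of_tendsto_of_le_of_le' (hcard.mul hlow) (hcard.mul hupp) ?_ ?_
  · filter_upwards [hterm, eventually_gt_atTop 0] with n hn hn0
    rw [hpow n hn0, ← nsmul_eq_mul]
    exact Finset.card_nsmul_le_sum _ _ _ fun a ha => (hn a ha).1
  · filter_upwards [hterm, eventually_gt_atTop 0] with n hn hn0
    rw [hpow n hn0, ← nsmul_eq_mul]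
    exact Finset.sum_le_card_nsmul _ _ _ fun a ha => (hn a ha).2

/-- For the zero-boundary DGFF on `V_N` and a fixed `δ ∈ (0,1/2)`: for every
bounded rectangle `A ⊆ [0,1]^d` and all `x < y ≤ +∞`, the sum over `α ∈ V_N^δ` with `α/n ∈ A` of
`P(u_N(x) < ψ_α ≤ u_N(y))` converges to `|A ∩ [δ,1-δ]^d|(e^{-x} - e^{-y})`. -/
theorem extremal_mean_measure_bulk
    (d : ℕ) (hd : 3 ≤ d) (δ : ℝ) (hδ0 : 0 < δ) (hδ : δ < 1 / 2)
    {Ω : Type*} [MeasurableSpace Ω] (P : Measure Ω) [IsProbabilityMeasure P]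
    (ψ : (n : ℕ) → Zd d → Ω → ℝ)
    (hψ : ∀ n, IsGaussianField P d (greenIn d (VN d n : Set (Zd d))) (ψ n))
    (hψ0 : ∀ n, ∀ a ∉ VN d n, ∀ᵐ ω ∂P, ψ n a ω = 0)
    (lo hi : Fin d → ℝ) (hlohi : ∀ i, lo i < hi i)
    (x : ℝ) (y : EReal) (hxy : (x : EReal) < y) :
    Tendsto
      (fun n : ℕ =>
        ∑ a ∈ rectIdxBulk d n δ lo hi,
          (P {ω | (uN (green d 0 0) (n ^ d) x : EReal) < (ψ n a ω : EReal) ∧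
                  (ψ n a ω : EReal) ≤ uNE (green d 0 0) (n ^ d) y}).toReal)
      atTop
      (nhds ((volume (rect d lo hi ∩ deltaBox d δ)).toReal * (Real.exp (-x) - expE y))) := by
  have hg : 0 < green d 0 0 := lt_of_lt_of_le one_pos (one_le_green d hd)
  have hx := tendsto_sum_bulk_tail d hd δ hδ0 P ψ hψ lo hi x
  induction y with
  | bot => exact absurd hxy not_lt_bot
  | top => simpa [uNE, expE, EReal.coe_lt_coe_iff, measureReal_def] using hx
  | coe r =>
    have hxr : x < r := EReal.coe_lt_coe_iff.mp hxy
    have hr := tendsto_sum_bulk_tail d hd δ hδ0 P ψ hψ lo hi r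
    have hlim := hx.sub hr
    rw [← mul_sub] at hlim
    simp only [uNE, expE, EReal.coe_ne_top, if_false, EReal.toReal_coe, EReal.coe_lt_coe_iff,
      EReal.coe_le_coe_iff]
    refine hlim.congr' ?_
    have hbN : ∀ᶠ n : ℕ in atTop, 0 < bN (green d 0 0) (n ^ d) := by
      have h := (tendsto_uN_atTop (green d 0 0) hg 0
        (tendsto_log_natCast_pow d (by omega))).eventually_gt_atTop 0
      simpa [uN] using h
    filter_upwards [hbN] with n hn
    have hu : uN (green d 0 0) (n ^ d) x ≤ uN (green d 0 0) (n ^ d) r := by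
      unfold uN aN
      gcongr
    rw [← Finset.sum_sub_distrib]
    refine Finset.sum_congr rfl fun a _ => ?_
    have hsub : {ω | uN (green d 0 0) (n ^ d) r < ψ n a ω} ⊆
        {ω | uN (green d 0 0) (n ^ d) x < ψ n a ω} := fun ω hω => hu.trans_lt hω
    rw [← measureReal_def, ← measureReal_sdiff hsub
      (measurableSet_lt measurable_const ((hψ n).1 a))]
    congr 1
    ext ω
    simp
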